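/- arXiv:math/0404328 — 4 statements merged into one kernel-verified Lean document; each statement's English description precedes it below -/
import Mathlib

section
/- Let (L, R) be a weak factorization system on the category Set of sets such that the map C: ∅ → {0} belongs to L and every member of L is injective. Then L = Mono and R = Epi. -/
universe u

/-- A class of morphisms of the category `Set` of sets. -/
abbrev MapClass : Type (u + 1) := ∀ (X Y : Type u), (X → Y) → Prop

/-- `i` has the left lifting property (LLP) with respect to `p`
(equivalently, `p` has the right lifting property (RLP) with respect to `i`):
every commutative square `p ∘ α = β ∘ i` admits a diagonal filler `g`. -/
def LiftSq {A B X Y : Type u} (i : A → B) (p : X → Y) : Prop :=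
  ∀ (α : A → X) (β : B → Y), p ∘ α = β ∘ i →
    ∃ g : B → X, g ∘ i = α ∧ p ∘ g = β

/-- `All`: the class of all set maps. -/
def AllMaps : MapClass.{u} := fun _ _ _ => True

/-- `Iso`: the class of bijections. -/
def IsoMaps : MapClass.{u} := fun _ _ f => Function.Bijective f

/-- `Mono`: the class of injections. -/
def MonoMaps : MapClass.{u} := fun _ _ f => Function.Injective f

/-- `Epi`: the class of surjections. -/
def EpiMaps : MapClass.{u} := fun _ _ f => Function.Surjective f

/-- `SplitMono`: the class of set maps having a left inverse. -/
def SplitMonoMaps : MapClass.{u} := fun X Y f => ∃ g : Y → X, g ∘ f = id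

/-- `Empty`: the class of set maps whose domain is empty. -/
def EmptyMaps : MapClass.{u} := fun X _Y _f => IsEmpty X

/-- `NonEmpty`: the class of set maps whose domain is nonempty. -/
def NonEmptyMaps : MapClass.{u} := fun X _Y _f => Nonempty X

/-- The union of two classes of set maps. -/
def unionMaps (P Q : MapClass.{u}) : MapClass.{u} := fun X Y f => P X Y f ∨ Q X Y f

/-- `(L, R)` is a weak factorization system on the category of sets:
`L` is exactly the class of maps having the LLP with respect to every member of `R`,
`R` is exactly the class of maps having the RLP with respect to every member of `L`,
and every set map factors as `r ∘ l` with `l ∈ L` and `r ∈ R`. -/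
structure IsWFS (L R : MapClass.{u}) : Prop where
  left_iff : ∀ {A B : Type u} (i : A → B),
    L A B i ↔ ∀ {X Y : Type u} (p : X → Y), R X Y p → LiftSq i p
  right_iff : ∀ {X Y : Type u} (p : X → Y),
    R X Y p ↔ ∀ {A B : Type u} (i : A → B), L A B i → LiftSq i p
  factor : ∀ {X Y : Type u} (f : X → Y),
    ∃ (Z : Type u) (l : X → Z) (r : Z → Y), L X Z l ∧ R Z Y r ∧ r ∘ l = f

/-- `C : ∅ → {0}`, the unique map from the empty set to a one-point set. -/
def Cmap : PEmpty.{u + 1} → PUnit.{u + 1} := fun x => x.elim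

theorem liftSq_of_injective_of_surjective {A B X Y : Type u} {i : A → B} {p : X → Y}
    (hi : Function.Injective i) (hp : Function.Surjective p) : LiftSq i p := by
  intro α β hsq
  refine ⟨Function.extend i α (Function.surjInv hp ∘ β), funext fun a => hi.extend_apply _ _ a,
    funext fun b => ?_⟩
  by_cases hb : ∃ a, i a = b
  · obtain ⟨a, rfl⟩ := hb
    simpa [hi.extend_apply] using congrFun hsq a
  · simp [Function.extend_apply' _ _ _ hb, Function.surjInv_eq]

theorem surjective_of_liftSq_Cmap {X Y : Type u} {p : X → Y}
    (hp : LiftSq Cmap.{u} p) : Function.Surjective p := by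
  intro y
  obtain ⟨g, -, hg⟩ := hp (fun x => x.elim) (fun _ => y) (funext fun x => x.elim)
  exact ⟨g PUnit.unit, congrFun hg PUnit.unit⟩

/-- If `(L, R)` is a weak factorization system on `Set` with `C ∈ L` and every member
of `L` injective, then `(L, R) = (Mono, Epi)`. -/
theorem wfs_eq_mono_epi (L R : MapClass.{u}) (h : IsWFS L R)
    (hC : L _ _ Cmap.{u})
    (hmono : ∀ {X Y : Type u} (f : X → Y), L X Y f → Function.Injective f) :
    L = MonoMaps ∧ R = EpiMaps := by
  have hepi : ∀ {X Y : Type u} (p : X → Y), R X Y p → Function.Surjective p := fun p hp =>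
    surjective_of_liftSq_Cmap ((h.right_iff p).1 hp _ hC)
  constructor
  · funext X Y f
    exact propext ⟨hmono f, fun hf => (h.left_iff f).2 fun p hp =>
      liftSq_of_injective_of_surjective hf (hepi p hp)⟩
  · funext X Y f
    exact propext ⟨hepi f, fun hf => (h.right_iff f).2 fun i hi =>
      liftSq_of_injective_of_surjective (hmono i hi) hf⟩
end

section
/- Let (L, R) be a weak factorization system on the category Set of sets such that C: ∅ → {0} does not belong to L, C⁺: {0} → {0,1} (with C⁺(0) = 0) belongs to L, and every member of L is injective. Then L = SplitMono and R = Epi ∪ Empty. -/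
universe u

/-- `C⁺ : {0} → {0, 1}`, with `C⁺(0) = 0` (here `0` is `false`). -/
def CplusMap : PUnit.{u + 1} → ULift.{u} Bool := fun _ => ULift.up false

/-- Split monomorphisms lift against surjections and against maps with empty domain. -/
theorem liftSq_of_splitMono {A B X Y : Type u} {i : A → B} {p : X → Y}
    (hi : SplitMonoMaps A B i) (hp : unionMaps EpiMaps EmptyMaps X Y p) : LiftSq i p := by
  classical
  obtain ⟨r, hr⟩ := hi
  intro α β hsq
  rcases hp with hp | hp
  · have hri : ∀ a, r (i a) = a := congrFun hr
    refine ⟨fun b => if i (r b) = b then α (r b) else Function.surjInv hp (β b), ?_, ?_⟩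
    · funext a
      simp [hri]
    · funext b
      by_cases hb : i (r b) = b
      · have := congrFun hsq (r b)
        simp_all
      · simp [hb, Function.surjInv_eq hp]
  · have : IsEmpty X := hp
    exact ⟨α ∘ r, by rw [Function.comp_assoc, hr, Function.comp_id],
      funext fun b => isEmptyElim (α (r b))⟩

/-- A map with the right lifting property against `C⁺` is surjective or has empty domain. -/
theorem epiOrEmpty_of_liftSq_Cplus {X Y : Type u} {p : X → Y}
    (hp : LiftSq CplusMap.{u} p) : unionMaps EpiMaps EmptyMaps X Y p := by
  rcases isEmpty_or_nonempty X with hX | ⟨⟨x⟩⟩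
  · exact Or.inr hX
  · refine Or.inl fun y => ?_
    obtain ⟨g, -, hg⟩ := hp (fun _ => x) (fun b => if b.down then y else p x)
      (by funext a; simp [CplusMap])
    exact ⟨g ⟨true⟩, by simpa using congrFun hg ⟨true⟩⟩

/-- `C` is a retract of every map from an empty set to a nonempty set, hence inherits
its left lifting properties. -/
theorem liftSq_Cmap_of_isEmpty {A B X Y : Type u} [IsEmpty A] [Nonempty B] {i : A → B}
    {p : X → Y} (hi : LiftSq i p) : LiftSq Cmap.{u} p := by
  intro α β _
  obtain ⟨g, -, hg⟩ := hi isEmptyElim (fun _ => β PUnit.unit) (funext isEmptyElim)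
  obtain ⟨b⟩ := ‹Nonempty B›
  exact ⟨fun _ => g b, funext fun x => x.elim, funext fun _ => congrFun hg b⟩

/-- If `(L, R)` is a weak factorization system on `Set` with `C ∉ L`, `C⁺ ∈ L` and
every member of `L` injective, then `(L, R) = (SplitMono, Epi ∪ Empty)`. -/
theorem wfs_eq_splitMono_epiOrEmpty (L R : MapClass.{u}) (h : IsWFS L R)
    (hC : ¬ L _ _ Cmap.{u}) (hCplus : L _ _ CplusMap.{u})
    (hmono : ∀ {X Y : Type u} (f : X → Y), L X Y f → Function.Injective f) :
    L = SplitMonoMaps ∧ R = unionMaps EpiMaps EmptyMaps := by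
  have hR : ∀ {X Y : Type u} (p : X → Y), R X Y p → unionMaps EpiMaps EmptyMaps X Y p :=
    fun p hp => epiOrEmpty_of_liftSq_Cplus ((h.right_iff p).1 hp _ hCplus)
  have hL : ∀ {A B : Type u} (i : A → B), L A B i → SplitMonoMaps A B i := by
    intro A B i hi
    rcases isEmpty_or_nonempty A with hA | hA
    · rcases isEmpty_or_nonempty B with hB | hB
      · exact ⟨isEmptyElim, funext isEmptyElim⟩
      · exact absurd ((h.left_iff _).2 fun p hp =>
          liftSq_Cmap_of_isEmpty ((h.left_iff i).1 hi p hp)) hC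
    · exact ⟨Function.invFun i, Function.invFun_comp (hmono i hi)⟩
  constructor
  · funext A B i
    exact propext ⟨hL i, fun hi => (h.left_iff i).2 fun p hp => liftSq_of_splitMono hi (hR p hp)⟩
  · funext X Y p
    exact propext ⟨hR p, fun hp => (h.right_iff p).2 fun i hi => liftSq_of_splitMono (hL i hi) hp⟩
end

section
/- Let (L, R) be a weak factorization system on the category Set of sets such that C: ∅ → {0} does not belong to L, C⁺: {0} → {0,1} (with C⁺(0) = 0) belongs to L, and some member of L is not injective. Then L = Iso ∪ NonEmpty and R = Iso ∪ Empty. -/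
universe u

theorem liftSq_of_bijective_left {A B X Y : Type u} {i : A → B} (p : X → Y)
    (hi : Function.Bijective i) : LiftSq i p := by
  obtain ⟨j, hl, hr⟩ := Function.bijective_iff_has_inverse.mp hi
  refine fun α β hsq => ⟨α ∘ j, funext fun a => congrArg α (hl a), funext fun b => ?_⟩
  exact (congrFun hsq (j b)).trans (congrArg β (hr b))

theorem liftSq_of_bijective_right {A B X Y : Type u} (i : A → B) {p : X → Y}
    (hp : Function.Bijective p) : LiftSq i p := by
  obtain ⟨q, hl, hr⟩ := Function.bijective_iff_has_inverse.mp hp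
  refine fun α β hsq => ⟨q ∘ β, funext fun a => ?_, funext fun b => hr (β b)⟩
  exact (congrArg q (congrFun hsq a)).symm.trans (hl (α a))

theorem liftSq_of_isoOrNonEmpty_of_isoOrEmpty {A B X Y : Type u} {i : A → B} {p : X → Y}
    (hi : unionMaps IsoMaps NonEmptyMaps A B i) (hp : unionMaps IsoMaps EmptyMaps X Y p) :
    LiftSq i p := by
  rcases hi with hi | ⟨⟨a⟩⟩
  · exact liftSq_of_bijective_left p hi
  rcases hp with hp | hp
  · exact liftSq_of_bijective_right i hp
  · exact fun α => ((show IsEmpty X from hp).false (α a)).elim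

theorem surjective_of_liftSq_cplusMap {X Y : Type u} [Nonempty X] {p : X → Y}
    (hp : LiftSq CplusMap.{u} p) : Function.Surjective p := by
  intro y
  obtain ⟨x⟩ := ‹Nonempty X›
  obtain ⟨g, -, hg⟩ := hp (fun _ => x) (fun b => if b.down then y else p x) rfl
  exact ⟨g ⟨true⟩, congrFun hg ⟨true⟩⟩

theorem injective_of_liftSq_of_not_injective {A B X Y : Type u} {f : A → B} {p : X → Y}
    (hf : ¬ Function.Injective f) (hp : LiftSq f p) : Function.Injective p := by
  classical
  simp only [Function.Injective, not_forall] at hf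
  obtain ⟨a, a', hfa, hne⟩ := hf
  intro x x' hx
  obtain ⟨g, hg, -⟩ := hp (fun c => if c = a then x else x') (fun _ => p x) (by
    funext c
    by_cases hc : c = a <;> simp [hc, hx])
  have h₁ : g (f a) = x := by simpa using congrFun hg a
  have h₂ : g (f a') = x' := by simpa [Ne.symm hne] using congrFun hg a'
  rw [← h₁, ← h₂, hfa]

theorem liftSq_cmap_of_surjective {X Y : Type u} {p : X → Y} (hp : Function.Surjective p) :
    LiftSq Cmap.{u} p := by
  intro α β _
  obtain ⟨x, hx⟩ := hp (β PUnit.unit)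
  exact ⟨fun _ => x, funext fun e => e.elim, funext fun _ => hx⟩

theorem isoOrNonEmpty_of_liftSq_empty {A B X Y : Type u} [IsEmpty X] [Nonempty Y] {i : A → B}
    {p : X → Y} (hi : LiftSq i p) : unionMaps IsoMaps NonEmptyMaps A B i := by
  rcases isEmpty_or_nonempty A with hA | hA
  · obtain ⟨y⟩ := ‹Nonempty Y›
    obtain ⟨g, -⟩ := hi isEmptyElim (fun _ => y) (funext isEmptyElim)
    have : IsEmpty B := Function.isEmpty g
    exact Or.inl ⟨Function.injective_of_subsingleton i, isEmptyElim⟩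
  · exact Or.inr hA

/-- If `(L, R)` is a weak factorization system on `Set` with `C ∉ L`, `C⁺ ∈ L` and
some member of `L` not injective, then `(L, R) = (Iso ∪ NonEmpty, Iso ∪ Empty)`. -/
theorem wfs_eq_isoOrNonEmpty_isoOrEmpty (L R : MapClass.{u}) (h : IsWFS L R)
    (hC : ¬ L _ _ Cmap.{u}) (hCplus : L _ _ CplusMap.{u})
    (hnotmono : ∃ (X Y : Type u) (f : X → Y), L X Y f ∧ ¬ Function.Injective f) :
    L = unionMaps IsoMaps NonEmptyMaps ∧ R = unionMaps IsoMaps EmptyMaps := by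
  obtain ⟨A, B, f, hf, hinj⟩ := hnotmono
  have hR {X Y : Type u} (p : X → Y) (hp : R X Y p) : unionMaps IsoMaps EmptyMaps X Y p := by
    rcases isEmpty_or_nonempty X with hX | hX
    · exact Or.inr hX
    · have hlift := fun {A B : Type u} (i : A → B) => (h.right_iff p).mp hp i
      exact Or.inl ⟨injective_of_liftSq_of_not_injective hinj (hlift f hf),
        surjective_of_liftSq_cplusMap (hlift _ hCplus)⟩
  have hL {A B : Type u} (i : A → B) (hi : L A B i) : unionMaps IsoMaps NonEmptyMaps A B i := by
    rw [h.left_iff] at hC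
    push Not at hC
    obtain ⟨X, Y, p, hp, hCp⟩ := hC
    have hsurj : ¬ Function.Surjective p := fun hs => hCp (liftSq_cmap_of_surjective hs)
    have : Nonempty Y := by
      by_contra hY
      exact hsurj fun y => (hY ⟨y⟩).elim
    have : IsEmpty X := (hR p hp).resolve_left fun hb => hsurj hb.2
    exact isoOrNonEmpty_of_liftSq_empty ((h.left_iff i).mp hi p hp)
  constructor
  · funext A B i
    refine propext ⟨hL i, fun hi => (h.left_iff i).mpr fun p hp => ?_⟩
    exact liftSq_of_isoOrNonEmpty_of_isoOrEmpty hi (hR p hp)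
  · funext X Y p
    refine propext ⟨hR p, fun hp => (h.right_iff p).mpr fun i hi => ?_⟩
    exact liftSq_of_isoOrNonEmpty_of_isoOrEmpty (hL i hi) hp
end

section
/- Let (L, R) be a weak factorization system on the category Set of sets such that L is not the class of bijections, C: ∅ → {0} does not belong to L, and C⁺: {0} → {0,1} (with C⁺(0) = 0) does not belong to L. Then L = Epi and R = Mono. -/
universe u

/-- The left lifting property is inherited by retracts in the arrow category. -/
theorem LiftSq.of_retract {A B A' B' X Y : Type u} {i : A → B} {i' : A' → B'} {p : X → Y}
    (h : LiftSq i p) (s : A' → A) (r : A → A') (s' : B' → B) (r' : B → B')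
    (hs : i ∘ s = s' ∘ i') (hr : i' ∘ r = r' ∘ i) (hrs : r ∘ s = id) (hrs' : r' ∘ s' = id) :
    LiftSq i' p := by
  intro α β hsq
  obtain ⟨g, hg, hpg⟩ := h (α ∘ r) (β ∘ r') (by
    rw [← Function.comp_assoc, hsq, Function.comp_assoc, hr, Function.comp_assoc])
  refine ⟨g ∘ s', ?_, ?_⟩
  · rw [Function.comp_assoc, ← hs, ← Function.comp_assoc, hg, Function.comp_assoc, hrs,
      Function.comp_id]
  · rw [← Function.comp_assoc, hpg, Function.comp_assoc, hrs', Function.comp_id]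

/-- Surjections lift against injections. -/
theorem LiftSq.of_surjective_of_injective {A B X Y : Type u} {i : A → B} {p : X → Y}
    (hi : Function.Surjective i) (hp : Function.Injective p) : LiftSq i p := by
  intro α β hsq
  choose s hs using hi
  have hpg : p ∘ α ∘ s = β := by
    rw [← Function.comp_assoc, hsq]
    exact funext fun b => congrArg β (hs b)
  refine ⟨α ∘ s, hp.comp_left ?_, hpg⟩
  change (p ∘ α ∘ s) ∘ i = p ∘ α
  rw [hpg, hsq]

/-- Bijections lift against every map. -/
theorem LiftSq.of_bijective {A B X Y : Type u} {i : A → B} (hi : Function.Bijective i)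
    (p : X → Y) : LiftSq i p := by
  obtain ⟨s, hsi, his⟩ := Function.bijective_iff_has_inverse.mp hi
  intro α β hsq
  refine ⟨α ∘ s, funext fun a => congrArg α (hsi a), funext fun b => ?_⟩
  exact (congrFun hsq (s b)).trans (congrArg β (his b))

/-- A map with the right lifting property against a non-injective map is injective. -/
theorem LiftSq.injective_right {A B X Y : Type u} {i : A → B} {p : X → Y} (h : LiftSq i p)
    (hi : ¬ Function.Injective i) : Function.Injective p := by
  classical
  intro x y hxy
  simp only [Function.Injective, not_forall] at hi
  obtain ⟨a, a', hia, hne⟩ := hi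
  obtain ⟨g, hg, -⟩ := h (fun c => if c = a then x else y) (fun _ => p x) (by
    funext c
    simp only [Function.comp_apply]
    split_ifs <;> simp [hxy])
  have ha : g (i a) = x := by simpa using congrFun hg a
  have ha' : g (i a') = y := by simpa [Ne.symm hne] using congrFun hg a'
  rw [← ha, ← ha', hia]

/-- Every map that a given non-surjective map lifts against has the right lifting property
against `C`, or every such map has it against `C⁺`. -/
theorem liftSq_Cmap_or_CplusMap_of_not_surjective {A B : Type u} {i : A → B} (hi : ¬ Function.Surjective i) :
    (∀ {X Y : Type u} (p : X → Y), LiftSq i p → LiftSq Cmap p) ∨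
      (∀ {X Y : Type u} (p : X → Y), LiftSq i p → LiftSq CplusMap p) := by
  classical
  simp only [Function.Surjective, not_forall] at hi
  obtain ⟨b, hb⟩ := hi
  rcases isEmpty_or_nonempty A with hA | ⟨⟨a⟩⟩
  · refine Or.inl fun p h => h.of_retract PEmpty.elim isEmptyElim (fun _ => b)
      (fun _ => PUnit.unit) ?_ ?_ ?_ ?_
    · exact funext fun x => x.elim
    · exact funext fun x => isEmptyElim x
    · exact funext fun x => x.elim
    · rfl
  · refine Or.inr fun p h => h.of_retract (fun _ => a) (fun _ => PUnit.unit)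
      (fun t => if t.down then b else i a) (fun c => ULift.up (decide (¬ ∃ x, i x = c))) ?_ ?_ ?_ ?_
    · funext x
      simp [CplusMap]
    · funext x
      simp [CplusMap]
    · rfl
    · funext ⟨t⟩
      cases t
      · simp
      · simpa using hb

/-- If `(L, R)` is a weak factorization system on `Set` with `L` not the class of
bijections, `C ∉ L` and `C⁺ ∉ L`, then `(L, R) = (Epi, Mono)`. -/
theorem wfs_eq_epi_mono (L R : MapClass.{u}) (h : IsWFS L R)
    (hL : L ≠ IsoMaps) (hC : ¬ L _ _ Cmap.{u}) (hCplus : ¬ L _ _ CplusMap.{u}) :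
    L = EpiMaps ∧ R = MonoMaps := by
  have lift {A B X Y : Type u} {i : A → B} {p : X → Y} (hi : L A B i) (hp : R X Y p) :
      LiftSq i p := (h.left_iff i).mp hi p hp
  have hsurj {A B : Type u} {i : A → B} (hi : L A B i) : Function.Surjective i := by
    by_contra hns
    rcases liftSq_Cmap_or_CplusMap_of_not_surjective hns with H | H
    · exact hC ((h.left_iff _).mpr fun p hp => H p (lift hi hp))
    · exact hCplus ((h.left_iff _).mpr fun p hp => H p (lift hi hp))
  obtain ⟨A, B, i, hi, hni⟩ : ∃ (A B : Type u) (i : A → B), L A B i ∧ ¬ Function.Injective i := by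
    by_contra! H
    refine hL ?_
    funext A B i
    exact propext ⟨fun hi => ⟨H A B i hi, hsurj hi⟩,
      fun hi => (h.left_iff i).mpr fun p _ => .of_bijective hi p⟩
  have hinj {X Y : Type u} {p : X → Y} (hp : R X Y p) : Function.Injective p :=
    (lift hi hp).injective_right hni
  constructor
  · funext A B i
    exact propext ⟨hsurj, fun hi => (h.left_iff i).mpr fun p hp =>
      .of_surjective_of_injective hi (hinj hp)⟩
  · funext X Y p
    exact propext ⟨hinj, fun hp => (h.right_iff p).mpr fun i hi =>
      .of_surjective_of_injective (hsurj hi) hp⟩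
end
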